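/- arXiv:math/0412272 — 3 statements merged into one kernel-verified Lean document; each statement's English description precedes it below -/
import Mathlib

section
/- Let g ≥ 1 and w ∈ W_g, and define μ_w(i) := max( max{w^{−1}(a) : 1 ≤ a ≤ i} − g, 0 ) for 1 ≤ i ≤ 2g. Then μ_w(i) ≥ ν_w(i) for all 1 ≤ i ≤ 2g, and equality μ_w(i) = ν_w(i) holds for all 1 ≤ i ≤ 2g if and only if w is final. -/
/-- `W_g`: the subgroup of permutations of `{1,…,2g}` (0-indexed as `Fin (2*g)`)
satisfying `w(i) + w(2g+1−i) = 2g+1` (in 1-indexed terms). -/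
def IsWeylC (g : ℕ) (w : Equiv.Perm (Fin (2 * g))) : Prop :=
  ∀ i : Fin (2 * g), ((w i : ℕ) + 1) + ((w i.rev : ℕ) + 1) = 2 * g + 1

/-- `r_w(i,j) = #{a : 1 ≤ a ≤ i, w(a) ≤ j}` (with `i j` 1-indexed bounds). -/
def rW (g : ℕ) (w : Equiv.Perm (Fin (2 * g))) (i j : ℕ) : ℕ :=
  (Finset.univ.filter (fun a : Fin (2 * g) => (a : ℕ) < i ∧ (w a : ℕ) < j)).card

/-- `w` is final: `w(i) < w(j)` for all `1 ≤ i < j ≤ g`. -/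
def IsFinalElt (g : ℕ) (w : Equiv.Perm (Fin (2 * g))) : Prop :=
  ∀ i j : Fin (2 * g), (i : ℕ) < (j : ℕ) → (j : ℕ) < g → (w i : ℕ) < (w j : ℕ)

/-- `ν_w(i) = i − r_w(g,i)`. -/
def nuW (g : ℕ) (w : Equiv.Perm (Fin (2 * g))) : ℕ → ℕ :=
  fun i => if i ≤ 2 * g then i - rW g w g i else g

/-- `μ_w(i) = ( max{w⁻¹(a) : 1 ≤ a ≤ i} − g )⁺`
(truncated subtraction on `ℕ` realises the positive part). -/
def muW (g : ℕ) (w : Equiv.Perm (Fin (2 * g))) (i : ℕ) : ℕ :=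
  ((Finset.univ.filter (fun a : Fin (2 * g) => (a : ℕ) < i)).sup
    (fun a => (w.symm a : ℕ) + 1)) - g

/-- The positions in the second half of `{0,…,2g-1}` whose `w`-value is less than `i`. -/
def upperPositions (g : ℕ) (w : Equiv.Perm (Fin (2 * g))) (i : ℕ) : Finset ℕ :=
  (Finset.univ.filter (fun b : Fin (2 * g) => g ≤ (b : ℕ) ∧ (w b : ℕ) < i)).map
    Fin.valEmbedding

lemma mem_upperPositions {g : ℕ} {w : Equiv.Perm (Fin (2 * g))} {i : ℕ} (b : Fin (2 * g)) :
    (b : ℕ) ∈ upperPositions g w i ↔ g ≤ (b : ℕ) ∧ (w b : ℕ) < i := by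
  simp only [upperPositions, Finset.mem_map, Finset.mem_filter, Finset.mem_univ, true_and,
    Fin.valEmbedding_apply]
  constructor
  · rintro ⟨a, ha, hab⟩
    rwa [← Fin.ext hab]
  · exact fun h => ⟨b, h, rfl⟩

lemma lt_of_mem_upperPositions {g : ℕ} {w : Equiv.Perm (Fin (2 * g))} {i n : ℕ}
    (h : n ∈ upperPositions g w i) : n < 2 * g := by
  obtain ⟨b, -, rfl⟩ := Finset.mem_map.mp h
  exact b.isLt

lemma card_filter_apply_lt {n : ℕ} (w : Equiv.Perm (Fin n)) {i : ℕ} (hi : i ≤ n) :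
    (Finset.univ.filter (fun b : Fin n => (w b : ℕ) < i)).card = i := by
  have h : (Finset.univ.filter (fun b : Fin n => (w b : ℕ) < i)).map
      (w.toEmbedding.trans Fin.valEmbedding) = Finset.range i := by
    ext k
    simp only [Finset.mem_map, Finset.mem_filter, Finset.mem_univ, true_and, Finset.mem_range]
    constructor
    · rintro ⟨b, hb, rfl⟩
      exact hb
    · intro hk
      exact ⟨w.symm ⟨k, by omega⟩, by simpa using hk, by simp⟩
  rw [← Finset.card_map, h, Finset.card_range]

lemma nuW_eq_card_upperPositions {g : ℕ} (w : Equiv.Perm (Fin (2 * g))) {i : ℕ}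
    (hi : i ≤ 2 * g) : nuW g w i = (upperPositions g w i).card := by
  have h := Finset.card_filter_add_card_filter_not
    (s := Finset.univ.filter (fun b : Fin (2 * g) => (w b : ℕ) < i))
    (fun b : Fin (2 * g) => (b : ℕ) < g)
  rw [card_filter_apply_lt w hi, Finset.filter_filter, Finset.filter_filter] at h
  simp only [nuW, if_pos hi, rW, upperPositions, Finset.card_map]
  simp only [not_lt, and_comm] at h ⊢
  omega

lemma muW_le_iff {g : ℕ} (w : Equiv.Perm (Fin (2 * g))) (i m : ℕ) :
    muW g w i ≤ m ↔ ∀ n ∈ upperPositions g w i, n < g + m := by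
  simp only [muW, Nat.sub_le_iff_le_add, Finset.sup_le_iff, Finset.mem_filter, Finset.mem_univ,
    true_and]
  constructor
  · intro h n hn
    lift n to Fin (2 * g) using lt_of_mem_upperPositions hn
    have := h (w n) ((mem_upperPositions n).mp hn).2
    simp only [Equiv.symm_apply_apply] at this
    omega
  · intro h a ha
    by_cases hg : g ≤ (w.symm a : ℕ)
    · have := h _ ((mem_upperPositions (w.symm a)).mpr ⟨hg, by simpa using ha⟩)
      omega
    · omega

lemma upperPositions_subset_Ico {g : ℕ} (w : Equiv.Perm (Fin (2 * g))) (i : ℕ) :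
    upperPositions g w i ⊆ Finset.Ico g (g + muW g w i) := by
  intro n hn
  have h := (muW_le_iff w i _).mp le_rfl n hn
  lift n to Fin (2 * g) using lt_of_mem_upperPositions hn
  exact Finset.mem_Ico.mpr ⟨((mem_upperPositions n).mp hn).1, h⟩

lemma isFinalElt_iff_upper {g : ℕ} {w : Equiv.Perm (Fin (2 * g))} (hw : IsWeylC g w) :
    IsFinalElt g w ↔ ∀ p q : Fin (2 * g), g ≤ (p : ℕ) → (p : ℕ) < q → (w p : ℕ) < w q := by
  constructor
  · intro h p q hp hpq
    have := h q.rev p.rev (by simp only [Fin.val_rev]; omega) (by simp only [Fin.val_rev]; omega)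
    have := hw p
    have := hw q
    omega
  · intro h i j hij hj
    have := h j.rev i.rev (by simp only [Fin.val_rev]; omega) (by simp only [Fin.val_rev]; omega)
    have := hw i
    have := hw j
    omega

/-- `μ_w(i) ≥ ν_w(i)` for all `1 ≤ i ≤ 2g`, with equality for
all such `i` iff `w` is final. -/
theorem stmt7 (g : ℕ) (hg : 1 ≤ g) (w : Equiv.Perm (Fin (2 * g))) (hw : IsWeylC g w) :
    (∀ i : ℕ, 1 ≤ i → i ≤ 2 * g → nuW g w i ≤ muW g w i) ∧
    ((∀ i : ℕ, 1 ≤ i → i ≤ 2 * g → muW g w i = nuW g w i) ↔ IsFinalElt g w) := by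
  have hle : ∀ i : ℕ, 1 ≤ i → i ≤ 2 * g → nuW g w i ≤ muW g w i := by
    intro i _ hi
    rw [nuW_eq_card_upperPositions w hi]
    simpa using Finset.card_le_card (upperPositions_subset_Ico w i)
  refine ⟨hle, ?_⟩
  rw [isFinalElt_iff_upper hw]
  constructor
  · intro h p q hp hpq
    by_contra hlt
    have hi : (w q : ℕ) + 1 ≤ 2 * g := (w q).isLt
    have heq := h _ (by omega) hi
    rw [nuW_eq_card_upperPositions w hi] at heq
    have hS := Finset.eq_of_subset_of_card_le (upperPositions_subset_Ico w (w q + 1))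
      (by simp [heq])
    have hq : (q : ℕ) ∈ upperPositions g w (w q + 1) :=
      (mem_upperPositions q).mpr ⟨by omega, by omega⟩
    have hmem : (p : ℕ) ∈ upperPositions g w (w q + 1) := by
      rw [hS, Finset.mem_Ico] at hq ⊢
      omega
    have hpw := ((mem_upperPositions p).mp hmem).2
    have : p = q := w.injective (Fin.ext (by omega))
    subst this
    omega
  · intro h i hi1 hi
    refine le_antisymm ?_ (hle i hi1 hi)
    rw [nuW_eq_card_upperPositions w hi, muW_le_iff]
    intro n hn
    lift n to Fin (2 * g) using lt_of_mem_upperPositions hn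
    obtain ⟨hgn, hwn⟩ := (mem_upperPositions n).mp hn
    have hsub : Finset.Ico g (n + 1) ⊆ upperPositions g w i := by
      intro c hc
      rw [Finset.mem_Ico] at hc
      lift c to Fin (2 * g) using by omega
      refine (mem_upperPositions c).mpr ⟨hc.1, ?_⟩
      rcases (Nat.lt_succ_iff.mp hc.2).lt_or_eq with hlt | heq
      · exact (h c n hc.1 hlt).trans hwn
      · rwa [Fin.ext heq]
    have := Finset.card_le_card hsub
    rw [Nat.card_Ico] at this
    omega
end

section
/- Let g ≥ 1, let w ∈ W_g, and let w_∅ ∈ W_g be the element with w_∅(i) = g+i for all 1 ≤ i ≤ g. The following are equivalent: (a) r_w(i,j) ≥ r_{w_∅}(i,j) for all 1 ≤ i, j ≤ 2g (i.e. w ≤ w_∅ in the Bruhat–Chevalley order); (b) w(i) ≤ g+i for all 1 ≤ i ≤ g; (c) r_w(i, g+i) = i for all 1 ≤ i ≤ g. -/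
theorem rW_eq_self_iff {g : ℕ} (w : Equiv.Perm (Fin (2 * g))) {i : ℕ} (hi : i ≤ 2 * g) (j : ℕ) :
    rW g w i j = i ↔ ∀ a : Fin (2 * g), (a : ℕ) < i → (w a : ℕ) < j := by
  have hcard : (Finset.univ.filter (fun a : Fin (2 * g) => (a : ℕ) < i)).card = i := by
    rw [Fin.card_filter_val_lt]; omega
  have hsub : Finset.univ.filter (fun a : Fin (2 * g) => (a : ℕ) < i ∧ (w a : ℕ) < j) ⊆
      Finset.univ.filter (fun a : Fin (2 * g) => (a : ℕ) < i) :=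
    Finset.monotone_filter_right _ fun _ _ h => h.1
  constructor
  · intro h a ha
    have heq := Finset.eq_of_subset_of_card_le hsub (by rw [hcard]; exact h.ge)
    have hmem : a ∈ Finset.univ.filter (fun a : Fin (2 * g) => (a : ℕ) < i) := by simpa using ha
    rw [← heq] at hmem
    exact (Finset.mem_filter.mp hmem).2.2
  · intro h
    rw [rW, ← hcard]
    congr 1
    ext a
    simp only [Finset.mem_filter, Finset.mem_univ, true_and, hcard]
    exact ⟨fun ha => ha.1, fun ha => ⟨ha, h a ha⟩⟩

theorem rW_le_left {g : ℕ} (w : Equiv.Perm (Fin (2 * g))) (i j : ℕ) : rW g w i j ≤ i := by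
  have h : rW g w i j ≤ (Finset.univ.filter (fun a : Fin (2 * g) => (a : ℕ) < i)).card :=
    Finset.card_le_card (Finset.monotone_filter_right _ fun _ _ h => h.1)
  rw [Fin.card_filter_val_lt] at h
  omega

theorem rW_symm {g : ℕ} (w : Equiv.Perm (Fin (2 * g))) (i j : ℕ) :
    rW g w.symm j i = rW g w i j := by
  refine Finset.card_equiv w.symm fun a => ?_
  simp [and_comm]

theorem rW_le_right {g : ℕ} (w : Equiv.Perm (Fin (2 * g))) (i j : ℕ) : rW g w i j ≤ j :=
  rW_symm w i j ▸ rW_le_left w.symm j i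

theorem rW_mono_left {g : ℕ} (w : Equiv.Perm (Fin (2 * g))) {i i' : ℕ} (h : i ≤ i') (j : ℕ) :
    rW g w i j ≤ rW g w i' j :=
  Finset.card_le_card (Finset.monotone_filter_right _ fun _ _ ha => ⟨ha.1.trans_le h, ha.2⟩)

theorem add_le_rW_add {g : ℕ} (w : Equiv.Perm (Fin (2 * g))) {i j : ℕ}
    (hi : i ≤ 2 * g) (hj : j ≤ 2 * g) : i + j ≤ rW g w i j + 2 * g := by
  have hci : (Finset.univ.filter (fun a : Fin (2 * g) => (a : ℕ) < i)).card = i := by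
    rw [Fin.card_filter_val_lt]; omega
  have hcj : (Finset.univ.filter (fun a : Fin (2 * g) => (w a : ℕ) < j)).card = j := by
    have h : (Finset.univ.filter (fun a : Fin (2 * g) => (w a : ℕ) < j)).card =
        (Finset.univ.filter (fun a : Fin (2 * g) => (a : ℕ) < j)).card :=
      Finset.card_equiv w fun a => by simp
    rw [h, Fin.card_filter_val_lt]; omega
  have hunion := Finset.card_union_add_card_inter
    (Finset.univ.filter (fun a : Fin (2 * g) => (a : ℕ) < i))
    (Finset.univ.filter (fun a : Fin (2 * g) => (w a : ℕ) < j))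
  rw [← Finset.filter_and, hci, hcj] at hunion
  have hle := Finset.card_le_univ
    (Finset.univ.filter (fun a : Fin (2 * g) => (a : ℕ) < i) ∪
      Finset.univ.filter (fun a : Fin (2 * g) => (w a : ℕ) < j))
  rw [Fintype.card_fin] at hle
  unfold rW
  omega

theorem min_le_rW_of_le_add {g : ℕ} (w : Equiv.Perm (Fin (2 * g)))
    (hw : ∀ a, (w a : ℕ) ≤ g + a) {i : ℕ} (hi : i ≤ 2 * g) (j : ℕ) :
    min i (j - g) ≤ rW g w i j := by
  have h := (rW_eq_self_iff w (i := min i (j - g)) (by omega) j).mpr fun a ha => by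
    have := hw a
    omega
  exact h.ge.trans (rW_mono_left w (min_le_left _ _) j)

theorem rW_le_sub_add_sub {g : ℕ} (w : Equiv.Perm (Fin (2 * g)))
    (hw : ∀ a : Fin (2 * g), (a : ℕ) < g → (w a : ℕ) = g + a) (i j : ℕ) :
    rW g w i j ≤ (i - g) + (j - g) := by
  have h : ((Finset.univ.filter
      (fun a : Fin (2 * g) => (a : ℕ) < i ∧ (w a : ℕ) < j)).map Fin.valEmbedding) ⊆
      Finset.Ico g i ∪ Finset.range (j - g) := by
    intro x hx
    simp only [Finset.mem_map, Finset.mem_filter, Finset.mem_univ, true_and] at hx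
    obtain ⟨a, ⟨hai, haj⟩, rfl⟩ := hx
    simp only [Finset.mem_union, Finset.mem_Ico, Finset.mem_range, Fin.valEmbedding_apply]
    have := hw a
    omega
  have h' := (Finset.card_le_card h).trans (Finset.card_union_le _ _)
  rwa [Finset.card_map, Nat.card_Ico, Finset.card_range] at h'

theorem IsWeylC.le_add_of_le_add {g : ℕ} {w : Equiv.Perm (Fin (2 * g))} (hw : IsWeylC g w)
    (h : ∀ a : Fin (2 * g), (a : ℕ) < g → (w a : ℕ) ≤ g + a) (a : Fin (2 * g)) :
    (a : ℕ) ≤ g + w a := by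
  have h1 := hw a
  have h2 := h a.rev
  have h3 := Fin.val_rev a
  omega

/-- for `w ∈ W_g` and `w_∅ ∈ W_g` the element with
`w_∅(i) = g+i` for `1 ≤ i ≤ g`, the following are equivalent:
(a) `r_w(i,j) ≥ r_{w_∅}(i,j)` for all `1 ≤ i,j ≤ 2g` (i.e. `w ≤ w_∅`);
(b) `w(i) ≤ g+i` for all `1 ≤ i ≤ g`;
(c) `r_w(i, g+i) = i` for all `1 ≤ i ≤ g`. -/
theorem stmt14 (g : ℕ) (hg : 1 ≤ g) (w wEmpty : Equiv.Perm (Fin (2 * g)))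
    (hw : IsWeylC g w) (hwe : IsWeylC g wEmpty)
    (hweval : ∀ i : Fin (2 * g), (i : ℕ) < g → (wEmpty i : ℕ) + 1 = g + ((i : ℕ) + 1)) :
    ((∀ i j : ℕ, 1 ≤ i → i ≤ 2 * g → 1 ≤ j → j ≤ 2 * g →
        rW g wEmpty i j ≤ rW g w i j) ↔
      (∀ i : Fin (2 * g), (i : ℕ) < g → (w i : ℕ) + 1 ≤ g + ((i : ℕ) + 1))) ∧
    ((∀ i : Fin (2 * g), (i : ℕ) < g → (w i : ℕ) + 1 ≤ g + ((i : ℕ) + 1)) ↔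
      (∀ i : ℕ, 1 ≤ i → i ≤ g → rW g w i (g + i) = i)) := by
  have hbc : (∀ i : Fin (2 * g), (i : ℕ) < g → (w i : ℕ) + 1 ≤ g + ((i : ℕ) + 1)) ↔
      (∀ i : ℕ, 1 ≤ i → i ≤ g → rW g w i (g + i) = i) := by
    constructor
    · intro hb i _ hig
      refine (rW_eq_self_iff w (by omega) _).mpr fun a ha => ?_
      have := hb a (by omega)
      omega
    · intro hc a ha
      have := (rW_eq_self_iff w (by omega) _).mp (hc (a + 1) (by omega) (by omega)) a (by omega)
      omega
  refine ⟨⟨fun ha => hbc.mpr fun i h1 hig => ?_, fun hb i j _ hi _ hj => ?_⟩, hbc⟩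
  · have hE : rW g wEmpty i (g + i) = i := by
      refine (rW_eq_self_iff wEmpty (by omega) _).mpr fun a ha => ?_
      have := hweval a (by omega)
      omega
    have := ha i (g + i) h1 (by omega) (by omega) (by omega)
    exact le_antisymm (rW_le_left w i _) (by omega)
  · have hw1 : ∀ a : Fin (2 * g), (w a : ℕ) ≤ g + a := fun a => by
      have := hb a
      omega
    have hw2 : ∀ a : Fin (2 * g), (w.symm a : ℕ) ≤ g + a := fun a => by
      simpa using hw.le_add_of_le_add (fun b _ => hw1 b) (w.symm a)
    have hE := rW_le_sub_add_sub wEmpty (fun a ha => by have := hweval a ha; omega) i j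
    have hEi := rW_le_left wEmpty i j
    have hEj := rW_le_right wEmpty i j
    have hL := min_le_rW_of_le_add w hw1 hi j
    have hR := min_le_rW_of_le_add w.symm hw2 hj i
    rw [rW_symm] at hR
    have hA := add_le_rW_add w hi hj
    omega
end

section
/- Let g ≥ 1, let w ∈ W_g be semi-simply final of semi-simple rank f, let I ⊆ {1,...,g} with #I = f, and set Ĩ := {g+1−i : i ∈ I}. Then w′ := σ^I w σ_I^{−1} satisfies w′(i) ≤ g+i for all 1 ≤ i ≤ g and {1 ≤ i ≤ g : w′(i) = g+i} = Ĩ. Conversely, every w′ ∈ W_g with w′(i) ≤ g+i for all 1 ≤ i ≤ g and {1 ≤ i ≤ g : w′(i) = g+i} = Ĩ equals σ^I w σ_I^{−1} for some semi-simply final w ∈ W_g of semi-simple rank f. -/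
/-- `w ∈ W_g` (with `w(i) ≤ g+i` for `1 ≤ i ≤ g`) is semi-simply final of
semi-simple rank `f`: its semi-simple index set `{i : w(i) = g+i}` equals
`{g−f+1,…,g}` (all 1-indexed). -/
def SemiSimplyFinal (g f : ℕ) (w : Equiv.Perm (Fin (2 * g))) : Prop :=
  IsWeylC g w ∧
  (∀ i : Fin (2 * g), (i : ℕ) < g → (w i : ℕ) ≤ g + (i : ℕ)) ∧
  (∀ i : Fin (2 * g), (i : ℕ) < g → ((w i : ℕ) = g + (i : ℕ) ↔ g - f ≤ (i : ℕ)))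

/-- `σ` is the shuffle `σ^I` associated to `I ⊆ {1,…,g}`: the unique element of
`W_g` stabilizing `{1,…,g}`, increasing on `{1,…,#I}` and on `{#I+1,…,g}`, and
with `{σ(1),…,σ(#I)} = I` (all 1-indexed). -/
def IsSigmaUp (g : ℕ) (I : Finset ℕ) (σ : Equiv.Perm (Fin (2 * g))) : Prop :=
  IsWeylC g σ ∧
  (∀ i : Fin (2 * g), (i : ℕ) < g → (σ i : ℕ) < g) ∧
  (∀ i j : Fin (2 * g), (i : ℕ) < (j : ℕ) → (j : ℕ) < I.card → (σ i : ℕ) < (σ j : ℕ)) ∧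
  (∀ i j : Fin (2 * g), I.card ≤ (i : ℕ) → (i : ℕ) < (j : ℕ) → (j : ℕ) < g →
    (σ i : ℕ) < (σ j : ℕ)) ∧
  (Finset.univ.filter (fun a : Fin (2 * g) => (a : ℕ) < I.card)).image
      (fun a => (σ a : ℕ) + 1) = I

/-- `σlo` is the shuffle `σ_I` determined by `σup = σ^I`:
`σ_I(i) = g+1−σ^I(g+1−i)` for `1 ≤ i ≤ g`, extended to an element of `W_g`. -/
def IsSigmaLo (g : ℕ) (σup σlo : Equiv.Perm (Fin (2 * g))) : Prop :=
  IsWeylC g σlo ∧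
  ∀ i : Fin (2 * g), ∀ _h : (i : ℕ) < g,
    ((σlo i : ℕ) + 1) + (((σup ⟨g - 1 - (i : ℕ), by omega⟩ : Fin (2 * g)) : ℕ) + 1)
      = g + 1

namespace IsWeylC

variable {g : ℕ} {v w : Equiv.Perm (Fin (2 * g))}

theorem apply_rev (hw : IsWeylC g w) (i : Fin (2 * g)) : w i.rev = (w i).rev := by
  have := hw i
  ext
  rw [Fin.val_rev]
  omega

theorem of_apply_rev (h : ∀ i, w i.rev = (w i).rev) : IsWeylC g w := by
  intro i
  rw [h, Fin.val_rev]
  omega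

theorem mul (hv : IsWeylC g v) (hw : IsWeylC g w) : IsWeylC g (v * w) :=
  of_apply_rev fun i => by simp [hw.apply_rev, hv.apply_rev]

theorem inv (hw : IsWeylC g w) : IsWeylC g w⁻¹ :=
  of_apply_rev fun i => by
    rw [Equiv.Perm.inv_eq_iff_eq, hw.apply_rev, ← Equiv.Perm.mul_apply, mul_inv_cancel, Equiv.Perm.one_apply]

theorem apply_lt_iff (hw : IsWeylC g w) (h : ∀ i : Fin (2 * g), (i : ℕ) < g → (w i : ℕ) < g)
    (i : Fin (2 * g)) : (w i : ℕ) < g ↔ (i : ℕ) < g := by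
  refine ⟨fun hi => ?_, h i⟩
  by_contra hge
  have h₁ := h i.rev (by rw [Fin.val_rev]; omega)
  have h₂ := hw i
  omega

end IsWeylC

namespace IsSigmaLo

variable {g : ℕ} {I : Finset ℕ} {σup σlo : Equiv.Perm (Fin (2 * g))}

theorem apply_lt_iff (hlo : IsSigmaLo g σup σlo) (i : Fin (2 * g)) :
    (σlo i : ℕ) < g ↔ (i : ℕ) < g := by
  refine hlo.1.apply_lt_iff (fun j hj => ?_) i
  have := hlo.2 j hj
  omega

/-- On `{g+1,…,2g}` the shuffle `σ^I` is the translate by `g` of `σ_I`. -/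
theorem up_apply_of_eq_add (hlo : IsSigmaLo g σup σlo) (hup : IsWeylC g σup)
    {i k : Fin (2 * g)} (hk : (k : ℕ) = g + i) : (σup k : ℕ) = g + σlo i := by
  have hi : (i : ℕ) < g := by omega
  have h₁ := hlo.2 i hi
  have h₂ := hup k
  have h₃ : k.rev = ⟨g - 1 - (i : ℕ), by omega⟩ := by
    ext
    rw [Fin.val_rev]
    dsimp only
    omega
  rw [h₃] at h₂
  omega

theorem up_apply_eq_add_iff (hlo : IsSigmaLo g σup σlo) (hup : IsWeylC g σup)
    {i : Fin (2 * g)} (hi : (i : ℕ) < g) (k : Fin (2 * g)) :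
    (σup k : ℕ) = g + σlo i ↔ (k : ℕ) = g + i := by
  refine ⟨fun h => ?_, hlo.up_apply_of_eq_add hup⟩
  have h₁ := hlo.up_apply_of_eq_add hup (i := i) (k := ⟨g + i, by omega⟩) rfl
  have h₂ : k = ⟨g + i, by omega⟩ := σup.injective (Fin.ext (h.trans h₁.symm))
  rw [h₂]

theorem apply_lt_apply (hlo : IsSigmaLo g σup σlo) (hup : IsSigmaUp g I σup)
    {i j : Fin (2 * g)} (hij : (i : ℕ) < j) (hj : (j : ℕ) < g - I.card) :
    (σlo i : ℕ) < σlo j := by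
  have h₁ := hlo.2 i (by omega)
  have h₂ := hlo.2 j (by omega)
  have h₃ := hup.2.2.2.1 ⟨g - 1 - (j : ℕ), by omega⟩ ⟨g - 1 - (i : ℕ), by omega⟩
    (by dsimp only; omega) (by dsimp only; omega) (by dsimp only; omega)
  omega

theorem apply_add_one_mem_iff (hlo : IsSigmaLo g σup σlo) (hup : IsSigmaUp g I σup)
    {i : Fin (2 * g)} (hi : (i : ℕ) < g) :
    (σlo i : ℕ) + 1 ∈ I.image (fun x => g + 1 - x) ↔ g - I.card ≤ i := by
  have hlo_i := hlo.2 i hi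
  have mem_iff (x : ℕ) : x ∈ I ↔ ∃ a : Fin (2 * g), (a : ℕ) < I.card ∧ (σup a : ℕ) + 1 = x := by
    conv_lhs => rw [← hup.2.2.2.2]
    simp
  simp only [Finset.mem_image, mem_iff]
  constructor
  · rintro ⟨_, ⟨a, ha, rfl⟩, h⟩
    have h₁ : a = ⟨g - 1 - (i : ℕ), by omega⟩ := σup.injective (Fin.ext (by omega))
    rw [h₁] at ha
    dsimp only at ha
    omega
  · intro h
    exact ⟨_, ⟨⟨g - 1 - (i : ℕ), by omega⟩, by dsimp only; omega, rfl⟩, by omega⟩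

end IsSigmaLo

/-- Conjugation by the shuffles turns semi-simple index set `{g−#I+1,…,g}` into
`{g+1−i : i ∈ I}`, for elements below `w_∅`. -/
theorem semiSimplyFinal_iff_shuffle {g : ℕ} {I : Finset ℕ}
    {σup σlo : Equiv.Perm (Fin (2 * g))} (hup : IsSigmaUp g I σup) (hlo : IsSigmaLo g σup σlo)
    (w : Equiv.Perm (Fin (2 * g))) :
    SemiSimplyFinal g I.card w ↔
      IsWeylC g (σup * w * σlo⁻¹) ∧
      (∀ i : Fin (2 * g), (i : ℕ) < g → ((σup * w * σlo⁻¹) i : ℕ) ≤ g + (i : ℕ)) ∧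
      (∀ i : Fin (2 * g), (i : ℕ) < g →
        (((σup * w * σlo⁻¹) i : ℕ) = g + (i : ℕ) ↔
          ((i : ℕ) + 1) ∈ I.image (fun x => g + 1 - x))) := by
  have reindex (p : Fin (2 * g) → Prop) :
      (∀ i : Fin (2 * g), (i : ℕ) < g → p i) ↔ ∀ j : Fin (2 * g), (j : ℕ) < g → p (σlo j) := by
    rw [← σlo.forall_congr_right]
    simp only [hlo.apply_lt_iff]
  have weyl_iff : IsWeylC g (σup * w * σlo⁻¹) ↔ IsWeylC g w := by
    refine ⟨fun h => ?_, fun h => (hup.1.mul h).mul hlo.1.inv⟩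
    simpa [mul_assoc] using (hup.1.inv.mul h).mul hlo.1
  have index_iff : (∀ j : Fin (2 * g), (j : ℕ) < g →
      ((σup (w j) : ℕ) = g + (σlo j : ℕ) ↔
        ((σlo j : ℕ) + 1) ∈ I.image (fun x => g + 1 - x))) ↔
      ∀ j : Fin (2 * g), (j : ℕ) < g → ((w j : ℕ) = g + (j : ℕ) ↔ g - I.card ≤ (j : ℕ)) := by
    refine forall₂_congr fun j hj => ?_
    rw [hlo.up_apply_eq_add_iff hup.1 hj, hlo.apply_add_one_mem_iff hup hj]
  have cancel (j : Fin (2 * g)) : (σup * w * σlo⁻¹) (σlo j) = σup (w j) := by simp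
  rw [SemiSimplyFinal, weyl_iff,
    reindex fun i => ((σup * w * σlo⁻¹) i : ℕ) ≤ g + (i : ℕ),
    reindex fun i => ((σup * w * σlo⁻¹) i : ℕ) = g + (i : ℕ) ↔ _]
  simp only [cancel, index_iff]
  refine and_congr_right fun _ => and_congr_left fun hss => forall₂_congr fun j hj => ?_
  by_cases hjf : g - I.card ≤ (j : ℕ)
  · have h := (hss j hj).2 hjf
    exact iff_of_true h.le (hlo.up_apply_of_eq_add hup.1 h).le
  by_cases hwj : (w j : ℕ) < g
  · have h := hup.2.1 (w j) hwj
    exact iff_of_true (by omega) (by omega)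
  obtain ⟨k, hk⟩ : ∃ k : Fin (2 * g), (w j : ℕ) = g + k :=
    ⟨⟨w j - g, by omega⟩, by dsimp only; omega⟩
  have hkg : (k : ℕ) < g := by omega
  have hkj : (k : ℕ) ≠ j := fun h => hjf ((hss j hj).1 (by omega))
  have hkf : (k : ℕ) < g - I.card := by
    by_contra hge
    refine hkj (congrArg Fin.val (w.injective (Fin.ext ?_)))
    rw [(hss k hkg).2 (by omega), hk]
  rw [hlo.up_apply_of_eq_add hup.1 hk, hk]
  rcases lt_or_gt_of_ne hkj with h | h
  · have := hlo.apply_lt_apply hup h (by omega)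
    omega
  · have := hlo.apply_lt_apply hup h hkf
    omega

/-- for `w ∈ W_g` semi-simply final of semi-simple rank `f` and
`I ⊆ {1,…,g}` with `#I = f`, the element `w' = σ^I w σ_I⁻¹` lies below `w_∅`
(i.e. `w'(i) ≤ g+i` for `1 ≤ i ≤ g`) and has semi-simple index set
`Ĩ = {g+1−i : i ∈ I}`; conversely every `w'' ∈ W_g` below `w_∅` with
semi-simple index set `Ĩ` is of this form. -/
theorem stmt15 (g : ℕ) (hg : 1 ≤ g) (f : ℕ) (hf : f ≤ g)
    (w : Equiv.Perm (Fin (2 * g))) (hw : SemiSimplyFinal g f w)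
    (I : Finset ℕ) (hI : I ⊆ Finset.Icc 1 g) (hIcard : I.card = f)
    (σup σlo : Equiv.Perm (Fin (2 * g)))
    (hup : IsSigmaUp g I σup) (hlo : IsSigmaLo g σup σlo) :
    (IsWeylC g (σup * w * σlo⁻¹) ∧
      (∀ i : Fin (2 * g), (i : ℕ) < g → ((σup * w * σlo⁻¹) i : ℕ) ≤ g + (i : ℕ)) ∧
      (∀ i : Fin (2 * g), (i : ℕ) < g →
        (((σup * w * σlo⁻¹) i : ℕ) = g + (i : ℕ) ↔
          ((i : ℕ) + 1) ∈ I.image (fun x => g + 1 - x)))) ∧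
    (∀ w'' : Equiv.Perm (Fin (2 * g)), IsWeylC g w'' →
      (∀ i : Fin (2 * g), (i : ℕ) < g → (w'' i : ℕ) ≤ g + (i : ℕ)) →
      (∀ i : Fin (2 * g), (i : ℕ) < g →
        ((w'' i : ℕ) = g + (i : ℕ) ↔ ((i : ℕ) + 1) ∈ I.image (fun x => g + 1 - x))) →
      ∃ w₀ : Equiv.Perm (Fin (2 * g)),
        SemiSimplyFinal g f w₀ ∧ w'' = σup * w₀ * σlo⁻¹) := by
  subst hIcard
  refine ⟨(semiSimplyFinal_iff_shuffle hup hlo w).1 hw, fun w'' h₁ h₂ h₃ => ?_⟩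
  have h : w'' = σup * (σup⁻¹ * w'' * σlo) * σlo⁻¹ := by group
  refine ⟨_, (semiSimplyFinal_iff_shuffle hup hlo _).2 ?_, h⟩
  rw [← h]
  exact ⟨h₁, h₂, h₃⟩
end
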